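/- If A : (0,∞) → S₊ is an S₊-valued locally integrable completely monotone (LICM) function, then the function p ↦ p·Ã(p), where Ã(p) = ∫₀^∞ e^{−pt} A(t) dt is the Laplace transform of A, is an S₊-valued complete Bernstein function (CBF) on (0,∞). -/

import Mathlib

open MeasureTheory Set Filter Topology Matrix

noncomputable section

/-- A matrix-valued function `A` on `(0,∞)` is completely monotone (CM): each entry is
infinitely differentiable on `(0,∞)` and for every `v : ℝ^m` and `n : ℕ`,
`(-1)^n (d/dt)^n (vᵀ A(t) v) ≥ 0` for `t > 0`. -/
def MatCM (m : ℕ) (A : ℝ → Matrix (Fin m) (Fin m) ℝ) : Prop :=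
  (∀ i j, ContDiffOn ℝ (⊤ : ℕ∞) (fun t => A t i j) (Set.Ioi 0)) ∧
  ∀ v : Fin m → ℝ, ∀ n : ℕ, ∀ t ∈ Set.Ioi (0:ℝ),
    0 ≤ (-1 : ℝ) ^ n * iteratedDeriv n (fun s => v ⬝ᵥ (A s).mulVec v) t

/-- Locally integrable completely monotone (LICM): CM and integrable over `(0,1]`. -/
def MatLICM (m : ℕ) (A : ℝ → Matrix (Fin m) (Fin m) ℝ) : Prop :=
  MatCM m A ∧ ∀ i j, MeasureTheory.IntegrableOn (fun t => A t i j) (Set.Ioc 0 1)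

/-- Entrywise derivative of a matrix-valued function. -/
def matDeriv (m : ℕ) (A : ℝ → Matrix (Fin m) (Fin m) ℝ) : ℝ → Matrix (Fin m) (Fin m) ℝ :=
  fun t => Matrix.of fun i j => deriv (fun s => A s i j) t

/-- A matrix-valued Bernstein function: differentiable on `(0,∞)` with CM derivative. -/
def MatBernstein (m : ℕ) (A : ℝ → Matrix (Fin m) (Fin m) ℝ) : Prop :=
  (∀ i j, DifferentiableOn ℝ (fun t => A t i j) (Set.Ioi 0)) ∧ MatCM m (matDeriv m A)

/-- The Laplace transform `Ã(p) = ∫₀^∞ e^{-pt} A(t) dt` (entrywise). -/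
def matLaplace (m : ℕ) (A : ℝ → Matrix (Fin m) (Fin m) ℝ) (p : ℝ) :
    Matrix (Fin m) (Fin m) ℝ :=
  Matrix.of fun i j => ∫ t in Set.Ioi (0:ℝ), Real.exp (-p * t) * A t i j

/-- Convolution of matrix-valued functions: `(A∗B)(t) = ∫₀ᵗ A(s) B(t-s) ds`. -/
def matConv (m : ℕ) (A B : ℝ → Matrix (Fin m) (Fin m) ℝ) (t : ℝ) :
    Matrix (Fin m) (Fin m) ℝ :=
  Matrix.of fun i j => ∫ s in (0:ℝ)..t, ∑ k, A s i k * B (t - s) k j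

/-- Convolution of a matrix-valued function with a vector-valued function:
`(A∗v)(t) = ∫₀ᵗ A(s) v(t-s) ds`. -/
def matVecConv (m : ℕ) (A : ℝ → Matrix (Fin m) (Fin m) ℝ) (v : ℝ → Fin m → ℝ) (t : ℝ) :
    Fin m → ℝ :=
  fun i => ∫ s in (0:ℝ)..t, ∑ k, A s i k * v (t - s) k

/-- An `S₊`-valued Stieltjes function: `Y(p) = C + ∫_{[0,∞)} (p + r)⁻¹ G(r) μ(dr)` with
`C ∈ S₊`, `μ` a Borel measure on `[0,∞)` with `∫ (1+r)⁻¹ μ(dr) < ∞`, and `G` a measurable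
`S₊`-valued function bounded `μ`-almost everywhere. -/
def IsStieltjesM (m : ℕ) (Y : ℝ → Matrix (Fin m) (Fin m) ℝ) : Prop :=
  ∃ (C : Matrix (Fin m) (Fin m) ℝ) (μ : MeasureTheory.Measure ℝ)
    (G : ℝ → Matrix (Fin m) (Fin m) ℝ),
    C.PosSemidef ∧ μ (Set.Iio 0) = 0 ∧
    (∫⁻ r in Set.Ici (0:ℝ), ENNReal.ofReal ((1 + r)⁻¹) ∂μ) < ⊤ ∧
    (∀ i j, Measurable fun r => G r i j) ∧
    (∀ᵐ r ∂μ, (G r).PosSemidef) ∧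
    (∃ M : ℝ, ∀ᵐ r ∂μ, ∀ i j, |G r i j| ≤ M) ∧
    ∀ p ∈ Set.Ioi (0:ℝ),
      Y p = C + Matrix.of fun i j => ∫ r in Set.Ici (0:ℝ), (p + r)⁻¹ * G r i j ∂μ

/-- An `S₊`-valued complete Bernstein function (CBF):
`Z(p) = p·B + p·∫_{[0,∞)} (p + r)⁻¹ H(r) ν(dr)` with `B ∈ S₊`, `ν` a Borel measure on
`[0,∞)` with `∫ (1+r)⁻¹ ν(dr) < ∞`, and `H` a measurable `S₊`-valued function bounded
`ν`-almost everywhere. -/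
def IsCBFM (m : ℕ) (Z : ℝ → Matrix (Fin m) (Fin m) ℝ) : Prop :=
  ∃ (B : Matrix (Fin m) (Fin m) ℝ) (ν : MeasureTheory.Measure ℝ)
    (H : ℝ → Matrix (Fin m) (Fin m) ℝ),
    B.PosSemidef ∧ ν (Set.Iio 0) = 0 ∧
    (∫⁻ r in Set.Ici (0:ℝ), ENNReal.ofReal ((1 + r)⁻¹) ∂ν) < ⊤ ∧
    (∀ i j, Measurable fun r => H r i j) ∧
    (∀ᵐ r ∂ν, (H r).PosSemidef) ∧
    (∃ M : ℝ, ∀ᵐ r ∂ν, ∀ i j, |H r i j| ≤ M) ∧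
    ∀ p ∈ Set.Ioi (0:ℝ),
      Z p = p • B + Matrix.of fun i j => ∫ r in Set.Ici (0:ℝ), p * (p + r)⁻¹ * H r i j ∂ν

/-- Scalar complete monotonicity on `(0,∞)`. -/
def ScalarCM (f : ℝ → ℝ) : Prop :=
  ContDiffOn ℝ (⊤ : ℕ∞) f (Set.Ioi 0) ∧
  ∀ n : ℕ, ∀ t ∈ Set.Ioi (0:ℝ), 0 ≤ (-1 : ℝ) ^ n * iteratedDeriv n f t

namespace ScalarCM

lemma contDiffAt {f : ℝ → ℝ} (hf : ScalarCM f) {t : ℝ} (ht : 0 < t) (n : ℕ) :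
    ContDiffAt ℝ n f t :=
  (hf.1.contDiffAt (Ioi_mem_nhds ht)).of_le (by exact_mod_cast le_top)

lemma antitoneOn_iteratedDeriv {f : ℝ → ℝ} (hf : ScalarCM f) (n : ℕ) :
    AntitoneOn (fun t => (-1 : ℝ) ^ n * iteratedDeriv n f t) (Set.Ioi 0) := by
  have hd : ∀ t ∈ Set.Ioi (0:ℝ), HasDerivAt (fun t => (-1 : ℝ) ^ n * iteratedDeriv n f t)
      ((-1 : ℝ) ^ n * iteratedDeriv (n + 1) f t) t := by
    intro t ht
    rw [iteratedDeriv_succ]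
    refine HasDerivAt.const_mul _ (DifferentiableAt.hasDerivAt ?_)
    have h1 : DifferentiableAt ℝ (iteratedFDeriv ℝ n f) t :=
      ContDiffAt.differentiableAt_iteratedFDeriv (n := ((n + 1 : ℕ) : WithTop ℕ∞))
        (hf.contDiffAt ht (n + 1)) (by exact_mod_cast Nat.lt_succ_self n)
    exact (ContinuousMultilinearMap.apply ℝ (fun _ : Fin n => ℝ) ℝ
      (fun _ => 1)).differentiableAt.comp t h1
  refine antitoneOn_of_deriv_nonpos (convex_Ioi 0)
    (fun t ht => (hd t ht).continuousAt.continuousWithinAt)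
    (fun t ht => (hd t (interior_subset ht)).differentiableAt.differentiableWithinAt) ?_
  intro t ht
  rw [(hd t (interior_subset ht)).deriv]
  have := hf.2 (n + 1) t (interior_subset ht)
  rw [pow_succ] at this
  linarith

lemma antitoneOn {f : ℝ → ℝ} (hf : ScalarCM f) : AntitoneOn f (Set.Ioi 0) := by
  simpa using hf.antitoneOn_iteratedDeriv 0

lemma sub_shift {f : ℝ → ℝ} (hf : ScalarCM f) {h : ℝ} (hh : 0 < h) :
    ScalarCM (fun t => f t - f (t + h)) := by
  have hpos : ∀ t ∈ Set.Ioi (0:ℝ), t + h ∈ Set.Ioi (0:ℝ) := fun t ht => add_pos ht hh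
  refine ⟨hf.1.sub (hf.1.comp (by fun_prop) hpos), fun n t ht => ?_⟩
  have h1 : iteratedDeriv n (fun t => f t - f (t + h)) t
      = iteratedDeriv n f t - iteratedDeriv n f (t + h) := by
    have := iteratedDeriv_fun_sub (n := n) (x := t) (f := f) (g := fun t => f (t + h))
      (hf.contDiffAt ht n)
      (ContDiffAt.comp t (hf.contDiffAt (hpos t ht) n) (by fun_prop))
    rw [this, iteratedDeriv_comp_add_const]
  rw [h1, mul_sub, sub_nonneg]
  exact hf.antitoneOn_iteratedDeriv n ht (hpos t ht) (by linarith)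

end ScalarCM

/-- The backward difference operator `a ↦ (k ↦ a k - a (k + 1))` on sequences. -/
def seqDiff (E : Type*) [AddCommGroup E] [Module ℝ E] : Module.End ℝ (ℕ → E) :=
  1 - LinearMap.funLeft ℝ E (fun k : ℕ => k + 1)

lemma seqDiff_apply {E : Type*} [AddCommGroup E] [Module ℝ E] (a : ℕ → E) (k : ℕ) :
    seqDiff E a k = a k - a (k + 1) := rfl

lemma ScalarCM.seqDiff_pow_nonneg {f : ℝ → ℝ} (hf : ScalarCM f) {h : ℝ} (hh : 0 < h) (n k : ℕ) :
    0 ≤ (seqDiff ℝ ^ n) (fun k => f (h * (k + 1))) k := by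
  induction n generalizing f with
  | zero => simpa using hf.2 0 (h * (k + 1)) (by simp only [mem_Ioi]; positivity)
  | succ n ih =>
    have := ih (hf.sub_shift hh)
    rw [pow_succ, Module.End.mul_apply]
    convert this using 3 with j
    simp only [seqDiff_apply]
    push_cast
    ring_nf

/-- Binomial inversion for iterated differences: `(S + D)^M = 1`. -/
lemma sum_choose_smul_seqDiff {E : Type*} [AddCommGroup E] [Module ℝ E] (a : ℕ → E) (M k : ℕ) :
    ∑ i ∈ Finset.range (M + 1), (M.choose i : ℝ) • (seqDiff E ^ (M - i)) a (k + i) = a k := by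
  set S : Module.End ℝ (ℕ → E) := LinearMap.funLeft ℝ E (fun k : ℕ => k + 1) with hS
  have hSD : S + seqDiff E = 1 := by rw [seqDiff]; abel
  have hc : Commute S (seqDiff E) := by
    rw [seqDiff]; exact (Commute.one_right _).sub_right (Commute.refl _)
  have hSi : ∀ i (b : ℕ → E), (S ^ i) b k = b (k + i) := by
    intro i
    induction i with
    | zero => intro b; simp
    | succ i ih =>
      intro b
      rw [pow_succ, Module.End.mul_apply, ih]
      rfl
  have h := hc.add_pow M
  rw [hSD, one_pow] at h
  have h2 := congrArg (fun T : Module.End ℝ (ℕ → E) => T a k) h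
  simp only [Module.End.one_apply, LinearMap.sum_apply, Finset.sum_apply] at h2
  rw [h2]
  refine Finset.sum_congr rfl fun i _ => ?_
  rw [← Nat.cast_comm, ← nsmul_eq_mul, LinearMap.smul_apply, Pi.smul_apply,
    Module.End.mul_apply, hSi, Nat.cast_smul_eq_nsmul]

lemma sum_descFactorial_smul_seqDiff {E : Type*} [AddCommGroup E] [Module ℝ E] (a : ℕ → E)
    {N k : ℕ} (hk : k ≤ N) :
    ∑ j ∈ Finset.range (N + 1),
      ((N.choose j : ℝ) * (j.descFactorial k : ℝ)) • (seqDiff E ^ (N - j)) a j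
      = (N.descFactorial k : ℝ) • a k := by
  obtain ⟨M, rfl⟩ := Nat.exists_eq_add_of_le hk
  rw [← sum_choose_smul_seqDiff a M k, Finset.smul_sum, add_assoc, Finset.sum_range_add,
    Finset.sum_eq_zero, zero_add]
  · refine Finset.sum_congr rfl fun i hi => ?_
    have hi' : i ≤ M := by simpa [Nat.lt_succ_iff] using hi
    rw [smul_smul, Nat.add_sub_add_left]
    congr 1
    have h1 : (k + M).choose (k + i) * (k + i).choose k = (k + M).choose k * M.choose i := by
      rw [Nat.choose_mul (Nat.le_add_right k i)]; simp
    rw [Nat.descFactorial_eq_factorial_mul_choose, Nat.descFactorial_eq_factorial_mul_choose]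
    have h2 : ((k + M).choose (k + i) * (k + i).choose k : ℝ) = (k + M).choose k * M.choose i := by
      exact_mod_cast h1
    push_cast
    linear_combination (k.factorial : ℝ) * h2
  · intro j hj
    rw [Nat.descFactorial_eq_zero_iff_lt.mpr (by simpa using hj)]
    simp

/-- A linear map from `C(X, ℝ)` to matrices is positive if it sends nonnegative functions to
positive semidefinite matrices. -/
def IsPosMap {X : Type*} [TopologicalSpace X] {m : ℕ}
    (L : C(X, ℝ) →ₗ[ℝ] Matrix (Fin m) (Fin m) ℝ) : Prop :=
  ∀ φ : C(X, ℝ), (∀ x, 0 ≤ φ x) → (L φ).PosSemidef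

lemma posSemidef_iff_real {m : ℕ} {M : Matrix (Fin m) (Fin m) ℝ} :
    M.PosSemidef ↔ (∀ i j, M i j = M j i) ∧ ∀ v : Fin m → ℝ, 0 ≤ v ⬝ᵥ M *ᵥ v := by
  rw [posSemidef_iff_dotProduct_mulVec]
  refine and_congr ?_ (by simp)
  rw [Matrix.IsHermitian.ext_iff]
  simp only [star_trivial]
  exact ⟨fun h i j => h j i, fun h i j => h j i⟩

lemma dotProduct_mulVec_eq_sum {m : ℕ} (M : Matrix (Fin m) (Fin m) ℝ) (v : Fin m → ℝ) :
    v ⬝ᵥ M *ᵥ v = ∑ i, ∑ j, v i * v j * M i j := by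
  simp only [dotProduct, mulVec, Finset.mul_sum]
  exact Finset.sum_congr rfl fun i _ => Finset.sum_congr rfl fun j _ => by ring

lemma pair_quadForm {m : ℕ} (M : Matrix (Fin m) (Fin m) ℝ) (i j : Fin m) (c : ℝ) :
    (Pi.single i 1 + c • Pi.single j 1) ⬝ᵥ M *ᵥ (Pi.single i 1 + c • Pi.single j 1)
      = M i i + c * (M i j + M j i) + c ^ 2 * M j j := by
  simp [mulVec_add, mulVec_smul, add_dotProduct, dotProduct_add]
  ring

lemma PosSemidef.abs_apply_le_trace {m : ℕ} {M : Matrix (Fin m) (Fin m) ℝ} (hM : M.PosSemidef)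
    (i j : Fin m) : |M i j| ≤ M.trace := by
  rw [posSemidef_iff_real] at hM
  have hd : ∀ i, 0 ≤ M i i := fun i => by simpa using hM.2 (Pi.single i 1)
  have hle : ∀ i, M i i ≤ M.trace := fun i =>
    Finset.single_le_sum (f := fun i => M i i) (fun i _ => hd i) (Finset.mem_univ i)
  have h1 := hM.2 (Pi.single i 1 + (1 : ℝ) • Pi.single j 1)
  have h2 := hM.2 (Pi.single i 1 + (-1 : ℝ) • Pi.single j 1)
  rw [pair_quadForm] at h1 h2
  have := hM.1 i j
  have := hle i
  have := hle j
  rw [abs_le]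
  constructor <;> linarith

lemma IsPosMap.abs_apply_le {X : Type*} [TopologicalSpace X] [CompactSpace X] {m : ℕ}
    {L : C(X, ℝ) →ₗ[ℝ] Matrix (Fin m) (Fin m) ℝ} (hL : IsPosMap L) (φ : C(X, ℝ)) (i j : Fin m) :
    |L φ i j| ≤ ‖φ‖ * (L 1).trace := by
  have h1 : (L (‖φ‖ • (1 : C(X, ℝ)) + φ)).PosSemidef := hL _ fun x => by
    have := neg_le_of_abs_le (φ.norm_coe_le_norm x)
    simp only [ContinuousMap.add_apply, ContinuousMap.smul_apply,
      ContinuousMap.one_apply, smul_eq_mul]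
    linarith
  have h2 : (L (‖φ‖ • (1 : C(X, ℝ)) - φ)).PosSemidef := hL _ fun x => by
    have := le_of_abs_le (φ.norm_coe_le_norm x)
    simp only [ContinuousMap.sub_apply, ContinuousMap.smul_apply,
      ContinuousMap.one_apply, smul_eq_mul]
    linarith
  have h3 := PosSemidef.abs_apply_le_trace h1 i j
  have h4 := PosSemidef.abs_apply_le_trace h2 i j
  rw [map_add, map_smul, trace_add, trace_smul, Matrix.add_apply, Matrix.smul_apply, smul_eq_mul,
    smul_eq_mul, abs_le] at h3
  rw [map_sub, map_smul, trace_sub, trace_smul, Matrix.sub_apply, Matrix.smul_apply, smul_eq_mul,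
    smul_eq_mul, abs_le] at h4
  rw [abs_le]
  constructor <;> linarith [h3.1, h3.2, h4.1, h4.2]

/-- Entries of a positive map as continuous linear functionals. -/
def IsPosMap.entryCLM {X : Type*} [TopologicalSpace X] [CompactSpace X] {m : ℕ}
    {L : C(X, ℝ) →ₗ[ℝ] Matrix (Fin m) (Fin m) ℝ} (hL : IsPosMap L) (i j : Fin m) :
    C(X, ℝ) →L[ℝ] ℝ :=
  LinearMap.mkContinuous (Matrix.entryLinearMap ℝ ℝ i j ∘ₗ L) (L 1).trace fun φ => by
    rw [mul_comm]; exact hL.abs_apply_le φ i j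

lemma IsPosMap.entryCLM_apply {X : Type*} [TopologicalSpace X] [CompactSpace X] {m : ℕ}
    {L : C(X, ℝ) →ₗ[ℝ] Matrix (Fin m) (Fin m) ℝ} (hL : IsPosMap L) (i j : Fin m) (φ : C(X, ℝ)) :
    hL.entryCLM i j φ = L φ i j := rfl

/-- Weak compactness: a trace-bounded family of positive maps converges along an ultrafilter to a
positive map. -/
lemma exists_posMap_ultrafilter_limit {X ι : Type*} [TopologicalSpace X] [CompactSpace X] {m : ℕ}
    (U : Ultrafilter ι) (L : ι → C(X, ℝ) →ₗ[ℝ] Matrix (Fin m) (Fin m) ℝ)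
    (hL : ∀ n, IsPosMap (L n)) {C : ℝ} (hC : ∀ n, (L n 1).trace ≤ C) :
    ∃ Λ : C(X, ℝ) →ₗ[ℝ] Matrix (Fin m) (Fin m) ℝ, IsPosMap Λ ∧
      ∀ (φ : C(X, ℝ)) (φs : ι → C(X, ℝ)), Tendsto φs U (𝓝 φ) →
        ∀ i j, Tendsto (fun n => L n (φs n) i j) U (𝓝 (Λ φ i j)) := by
  have hbd : ∀ n φ i j, |L n φ i j| ≤ ‖φ‖ * C := fun n φ i j =>
    ((hL n).abs_apply_le φ i j).trans (mul_le_mul_of_nonneg_left (hC n) (norm_nonneg φ))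
  have hlim : ∀ (φ : C(X, ℝ)) i j, ∃ l, Tendsto (fun n => L n φ i j) U (𝓝 l) := by
    intro φ i j
    obtain ⟨l, -, hl⟩ := (isCompact_Icc (a := -(‖φ‖ * C)) (b := ‖φ‖ * C)).ultrafilter_le_nhds
      (U.map fun n => L n φ i j)
      (by
        rw [le_principal_iff, Ultrafilter.coe_map, Filter.mem_map]
        exact Filter.univ_mem' fun n => abs_le.mp (hbd n φ i j))
    exact ⟨l, hl⟩
  choose ℓ hℓ using hlim
  let Λ : C(X, ℝ) →ₗ[ℝ] Matrix (Fin m) (Fin m) ℝ :=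
    { toFun := fun φ => Matrix.of fun i j => ℓ φ i j
      map_add' := fun φ ψ => by
        ext i j
        refine tendsto_nhds_unique (hℓ (φ + ψ) i j) ?_
        simpa using (hℓ φ i j).add (hℓ ψ i j)
      map_smul' := fun c φ => by
        ext i j
        refine tendsto_nhds_unique (hℓ (c • φ) i j) ?_
        simpa using (hℓ φ i j).const_mul c }
  have hΛ : ∀ φ i j, Tendsto (fun n => L n φ i j) U (𝓝 (Λ φ i j)) := hℓ
  refine ⟨Λ, fun φ hφ => ?_, fun φ φs hφs i j => ?_⟩
  · have hn := fun n => posSemidef_iff_real.mp (hL n φ hφ)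
    refine posSemidef_iff_real.mpr ⟨fun i j => ?_, fun v => ?_⟩
    · refine tendsto_nhds_unique (hΛ φ i j) ?_
      simpa only [(hn _).1 i j] using hΛ φ j i
    · have ht : Tendsto (fun n => v ⬝ᵥ L n φ *ᵥ v) U (𝓝 (v ⬝ᵥ Λ φ *ᵥ v)) := by
        simp only [dotProduct_mulVec_eq_sum]
        exact tendsto_finsetSum _ fun i _ => tendsto_finsetSum _ fun j _ =>
          (hΛ φ i j).const_mul _
      exact ge_of_tendsto' ht fun n => (hn n).2 v
  · have h0 : Tendsto (fun n => L n (φs n - φ) i j) U (𝓝 0) := by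
      have hb : ∀ n, ‖L n (φs n - φ) i j‖ ≤ ‖φs n - φ‖ * C := fun n => hbd n (φs n - φ) i j
      refine squeeze_zero_norm hb ?_
      simpa using (tendsto_iff_norm_sub_tendsto_zero.mp hφs).mul_const C
    simpa using h0.add (hΛ φ i j)

/-- The coordinate function on the unit interval. -/
def coordMap : C(unitInterval, ℝ) := ⟨Subtype.val, continuous_subtype_val⟩

lemma prod_sub_eq_descFactorial (j k : ℕ) :
    ∏ i ∈ Finset.range k, ((j : ℝ) - i) = j.descFactorial k := by
  induction k with
  | zero => simp
  | succ k ih =>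
    rw [Finset.prod_range_succ, ih, Nat.descFactorial_succ]
    rcases le_or_gt k j with h | h
    · push_cast [Nat.cast_sub h]; ring
    · rw [Nat.descFactorial_eq_zero_iff_lt.mpr h]; simp

lemma prod_div_sub_div_eq (j k : ℕ) (N : ℝ) :
    ∏ i ∈ Finset.range k, ((j : ℝ) / N - i / N) = (j.descFactorial k : ℝ) / N ^ k := by
  simp_rw [← sub_div]
  rw [Finset.prod_div_distrib, prod_sub_eq_descFactorial]
  simp

/-- The Bernstein-type positive functional attached to a matrix sequence. -/
def bernsteinMap {m : ℕ} (a : ℕ → Matrix (Fin m) (Fin m) ℝ) (N : ℕ) :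
    C(unitInterval, ℝ) →ₗ[ℝ] Matrix (Fin m) (Fin m) ℝ where
  toFun φ := ∑ j ∈ Finset.range (N + 1),
    ((N.choose j : ℝ) * φ (Set.projIcc 0 1 zero_le_one ((j : ℝ) / N))) •
      (seqDiff (Matrix (Fin m) (Fin m) ℝ) ^ (N - j)) a j
  map_add' φ ψ := by
    simp only [ContinuousMap.add_apply, mul_add, add_smul, Finset.sum_add_distrib]
  map_smul' c φ := by
    simp only [ContinuousMap.smul_apply, smul_eq_mul, RingHom.id_apply, Finset.smul_sum, smul_smul]
    exact Finset.sum_congr rfl fun j _ => by congr 1; ring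

lemma bernsteinMap_apply {m : ℕ} (a : ℕ → Matrix (Fin m) (Fin m) ℝ) (N : ℕ)
    (φ : C(unitInterval, ℝ)) :
    bernsteinMap a N φ = ∑ j ∈ Finset.range (N + 1),
      ((N.choose j : ℝ) * φ (Set.projIcc 0 1 zero_le_one ((j : ℝ) / N))) •
        (seqDiff (Matrix (Fin m) (Fin m) ℝ) ^ (N - j)) a j := rfl

lemma isPosMap_bernsteinMap {m : ℕ} {a : ℕ → Matrix (Fin m) (Fin m) ℝ}
    (ha : ∀ n k, ((seqDiff _ ^ n) a k).PosSemidef) (N : ℕ) : IsPosMap (bernsteinMap a N) := by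
  intro φ hφ
  rw [bernsteinMap_apply]
  exact Matrix.posSemidef_sum _ fun j _ =>
    (ha _ _).smul (mul_nonneg (Nat.cast_nonneg _) (hφ _))

/-- The monic polynomial function with roots `0, 1/N, …, (k-1)/N`. -/
def fallingMap (N k : ℕ) : C(unitInterval, ℝ) :=
  ∏ i ∈ Finset.range k, (coordMap - ContinuousMap.const _ ((i : ℝ) / N))

lemma tendsto_fallingMap (k : ℕ) :
    Tendsto (fun N => fallingMap N k) atTop (𝓝 (coordMap ^ k)) := by
  have h : ∀ i ∈ Finset.range k, Tendsto (fun N : ℕ =>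
      coordMap - ContinuousMap.const unitInterval ((i : ℝ) / N)) atTop (𝓝 coordMap) := by
    intro i _
    have h1 : Tendsto (fun N : ℕ => ContinuousMap.const unitInterval ((i : ℝ) / N)) atTop
        (𝓝 (ContinuousMap.const unitInterval 0)) :=
      (ContinuousMap.continuous_const'.tendsto (0 : ℝ)).comp
        (tendsto_const_div_atTop_nhds_zero_nat (i : ℝ))
    have h2 := (tendsto_const_nhds (x := coordMap)).sub h1
    rwa [show coordMap - ContinuousMap.const unitInterval (0 : ℝ) = coordMap by ext; simp] at h2
  have := tendsto_finsetProd (Finset.range k) h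
  simpa [fallingMap] using this

lemma bernsteinMap_fallingMap {m : ℕ} (a : ℕ → Matrix (Fin m) (Fin m) ℝ) {N k : ℕ} (hN : 0 < N)
    (hk : k ≤ N) : bernsteinMap a N (fallingMap N k) = fallingMap N k 1 • a k := by
  have hN' : (0 : ℝ) < N := by exact_mod_cast hN
  have hval : ∀ j ≤ N, fallingMap N k (Set.projIcc 0 1 zero_le_one ((j : ℝ) / N))
      = (j.descFactorial k : ℝ) / (N : ℝ) ^ k := by
    intro j hj
    have hmem : (j : ℝ) / N ∈ Set.Icc (0 : ℝ) 1 :=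
      ⟨by positivity, div_le_one_of_le₀ (by exact_mod_cast hj) hN'.le⟩
    rw [Set.projIcc_of_mem _ hmem, ← prod_div_sub_div_eq]
    simp [fallingMap, ContinuousMap.prod_apply, coordMap]
  have hone : fallingMap N k 1 = (N.descFactorial k : ℝ) / (N : ℝ) ^ k := by
    rw [← hval N le_rfl, div_self hN'.ne', Set.projIcc_right]
    rfl
  rw [hone, div_eq_inv_mul, ← smul_smul, ← sum_descFactorial_smul_seqDiff a hk, Finset.smul_sum,
    bernsteinMap_apply]
  refine Finset.sum_congr rfl fun j hj => ?_
  rw [hval j (by simpa [Nat.lt_succ_iff] using hj), smul_smul]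
  congr 1
  ring

/-- Matrix-valued Hausdorff moment problem: existence of a positive functional with given
completely monotone moments. -/
lemma exists_posMap_moments {m : ℕ} {a : ℕ → Matrix (Fin m) (Fin m) ℝ}
    (ha : ∀ n k, ((seqDiff _ ^ n) a k).PosSemidef) :
    ∃ Λ : C(unitInterval, ℝ) →ₗ[ℝ] Matrix (Fin m) (Fin m) ℝ, IsPosMap Λ ∧
      ∀ k, Λ (coordMap ^ k) = a k := by
  have h1 : ∀ N, bernsteinMap a N 1 = a 0 := by
    intro N
    simpa [bernsteinMap_apply] using sum_descFactorial_smul_seqDiff a (Nat.zero_le N)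
  obtain ⟨Λ, hΛ, hlim⟩ := exists_posMap_ultrafilter_limit (hyperfilter ℕ) (bernsteinMap a)
    (isPosMap_bernsteinMap ha) (C := (a 0).trace) (fun N => by rw [h1])
  refine ⟨Λ, hΛ, fun k => ?_⟩
  have hU : (hyperfilter ℕ : Filter ℕ) ≤ atTop := Nat.hyperfilter_le_atTop
  have hf := (tendsto_fallingMap k).mono_left hU
  ext i j
  refine tendsto_nhds_unique (hlim _ _ hf i j) ?_
  have he : Tendsto (fun N => fallingMap N k 1) (hyperfilter ℕ) (𝓝 1) := by
    have := ((continuous_eval_const (1 : unitInterval)).tendsto _).comp hf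
    simpa [coordMap, Function.comp_def] using this
  have he2 : Tendsto (fun N => fallingMap N k 1 * a k i j) (hyperfilter ℕ) (𝓝 (a k i j)) := by
    simpa using he.mul_const (a k i j)
  refine he2.congr' (hU ?_)
  filter_upwards [eventually_ge_atTop (k + 1)] with N hN
  rw [bernsteinMap_fallingMap a (by omega) (by omega), Matrix.smul_apply, smul_eq_mul]

/-- The step-function integrand whose integral is a Riemann sum for `∫ e^{-pt} f(t) dt`. -/
def laplaceStep (p : ℝ) (f : ℝ → ℝ) (h t : ℝ) : ℝ :=
  ((1 + p * h)⁻¹) ^ ⌈t / h⌉₊ * f (h * ⌈t / h⌉₊)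

lemma le_mul_ceil {h : ℝ} (hh : 0 < h) (t : ℝ) : t ≤ h * ⌈t / h⌉₊ := by
  have := Nat.le_ceil (t / h)
  rwa [div_le_iff₀' hh] at this

lemma ceil_div_eq {h t : ℝ} (hh : 0 < h) {k : ℕ} (ht : t ∈ Set.Ioc (h * k) (h * (k + 1))) :
    ⌈t / h⌉₊ = k + 1 := by
  rw [Nat.ceil_eq_iff (Nat.succ_ne_zero k)]
  rw [lt_div_iff₀' hh, div_le_iff₀' hh]
  simpa using ht

lemma integrableOn_exp_mul_of_antitoneOn {g : ℝ → ℝ} (hg : AntitoneOn g (Set.Ioi 0))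
    (hg0 : ∀ t ∈ Set.Ioi (0:ℝ), 0 ≤ g t) (hgc : ContinuousOn g (Set.Ioi 0))
    (hgi : IntegrableOn g (Set.Ioc 0 1)) {q : ℝ} (hq : 0 < q) :
    IntegrableOn (fun t => Real.exp (-q * t) * g t) (Set.Ioi 0) := by
  have hm : ∀ s ⊆ Set.Ioi (0:ℝ), MeasurableSet s →
      AEStronglyMeasurable (fun t => Real.exp (-q * t) * g t) (volume.restrict s) := fun s hs hms =>
    ((by fun_prop : Continuous fun t => Real.exp (-q * t)).continuousOn.mul
      (hgc.mono hs)).aestronglyMeasurable hms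
  have hsub : Set.Ioi (1:ℝ) ⊆ Set.Ioi 0 := Set.Ioi_subset_Ioi zero_le_one
  rw [← Set.Ioc_union_Ioi_eq_Ioi zero_le_one]
  refine IntegrableOn.union ?_ ?_
  · refine Integrable.mono' hgi (hm _ (fun t ht => ht.1) measurableSet_Ioc) ?_
    filter_upwards [ae_restrict_mem measurableSet_Ioc] with t ht
    have h0 := hg0 t ht.1
    rw [Real.norm_of_nonneg (by positivity)]
    refine mul_le_of_le_one_left h0 (Real.exp_le_one_iff.mpr ?_)
    nlinarith [ht.1]
  · refine Integrable.mono' ((integrableOn_exp_mul_Ioi (neg_lt_zero.mpr hq) 1).mul_const (g 1))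
      (hm _ hsub measurableSet_Ioi) ?_
    filter_upwards [ae_restrict_mem measurableSet_Ioi] with t ht
    have h0 := hg0 t (hsub ht)
    rw [Real.norm_of_nonneg (by positivity)]
    exact mul_le_mul_of_nonneg_left (hg (by simp) (hsub ht) (le_of_lt ht)) (Real.exp_pos _).le

lemma abs_laplaceStep_le {f g : ℝ → ℝ} (hg : AntitoneOn g (Set.Ioi 0))
    (hfg : ∀ t ∈ Set.Ioi (0:ℝ), |f t| ≤ g t) {p h : ℝ} (hp : 0 < p) (hh : 0 < h) (hh1 : h ≤ 1)
    {t : ℝ} (ht : 0 < t) :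
    |laplaceStep p f h t| ≤ Real.exp (-Real.log (1 + p) * t) * g t := by
  have hle := le_mul_ceil hh t
  have hpos : 0 < h * (⌈t / h⌉₊ : ℝ) := ht.trans_le hle
  have h1 : |f (h * ⌈t / h⌉₊)| ≤ g t := (hfg _ hpos).trans (hg ht hpos hle)
  have hb : (1 + p) ^ h ≤ 1 + p * h := by
    have := rpow_one_add_le_one_add_mul_self (s := p) (by linarith) hh.le hh1
    linarith
  have hq : 0 < Real.log (1 + p) := Real.log_pos (by linarith)
  have h2 : ((1 + p * h)⁻¹) ^ ⌈t / h⌉₊ ≤ Real.exp (-Real.log (1 + p) * t) := by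
    calc ((1 + p * h)⁻¹) ^ ⌈t / h⌉₊ ≤ (((1 + p) ^ h)⁻¹) ^ ⌈t / h⌉₊ := by
          have : 0 < (1 + p) ^ h := Real.rpow_pos_of_pos (by linarith) h
          gcongr
      _ = Real.exp (-Real.log (1 + p) * (h * ⌈t / h⌉₊)) := by
          rw [Real.rpow_def_of_pos (by linarith), ← Real.exp_neg, ← Real.exp_nat_mul]
          congr 1; ring
      _ ≤ _ := Real.exp_le_exp.mpr (by nlinarith)
  have h3 : 0 ≤ ((1 + p * h)⁻¹) ^ ⌈t / h⌉₊ := by positivity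
  rw [laplaceStep, abs_mul, abs_of_nonneg h3]
  exact mul_le_mul h2 h1 (abs_nonneg _) (Real.exp_pos _).le

lemma measurable_laplaceStep (p : ℝ) (f : ℝ → ℝ) (h : ℝ) : Measurable (laplaceStep p f h) := by
  have h1 : Measurable fun n : ℕ => ((1 + p * h)⁻¹) ^ n * f (h * n) := measurable_from_nat
  exact h1.comp (Nat.measurable_ceil.comp (measurable_id.div_const h))

lemma hasSum_laplaceStep {f g : ℝ → ℝ} (hg : AntitoneOn g (Set.Ioi 0))
    (hfg : ∀ t ∈ Set.Ioi (0:ℝ), |f t| ≤ g t) (hgc : ContinuousOn g (Set.Ioi 0))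
    (hgi : IntegrableOn g (Set.Ioc 0 1)) {p h : ℝ} (hp : 0 < p) (hh : 0 < h) (hh1 : h ≤ 1) :
    HasSum (fun k : ℕ => h * ((1 + p * h)⁻¹) ^ (k + 1) * f (h * (k + 1)))
      (∫ t in Set.Ioi 0, laplaceStep p f h t) := by
  have hU : ⋃ k : ℕ, Set.Ioc (h * k) (h * (k + 1)) = Set.Ioi (0:ℝ) := by
    ext t
    simp only [Set.mem_iUnion, Set.mem_Ioi]
    constructor
    · rintro ⟨k, hk⟩
      exact lt_of_le_of_lt (by positivity) hk.1
    · intro ht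
      have hc : 0 < ⌈t / h⌉₊ := Nat.ceil_pos.mpr (by positivity)
      refine ⟨⌈t / h⌉₊ - 1, ?_, ?_⟩
      · rw [← lt_div_iff₀' hh]
        exact (Nat.ceil_eq_iff hc.ne').mp rfl |>.1
      · rw [Nat.cast_sub hc]
        simpa using le_mul_ceil hh t
  have hint : IntegrableOn (laplaceStep p f h) (Set.Ioi 0) := by
    refine Integrable.mono' (integrableOn_exp_mul_of_antitoneOn hg
      (fun t ht => (abs_nonneg _).trans (hfg t ht)) hgc hgi
      (Real.log_pos (by linarith : 1 < 1 + p))) (measurable_laplaceStep p f h).aestronglyMeasurable ?_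
    filter_upwards [ae_restrict_mem measurableSet_Ioi] with t ht
    exact abs_laplaceStep_le hg hfg hp hh hh1 ht
  have := hasSum_integral_iUnion (μ := volume) (f := laplaceStep p f h)
    (s := fun k : ℕ => Set.Ioc (h * k) (h * (k + 1))) (fun _ => measurableSet_Ioc)
    (fun k l hkl => Set.disjoint_left.mpr fun t hk hl => hkl (by
      have := (ceil_div_eq hh hk).symm.trans (ceil_div_eq hh hl)
      omega)) (by rwa [hU])
  rw [hU] at this
  refine this.congr_fun fun k => ?_
  rw [setIntegral_congr_fun (g := fun _ => ((1 + p * h)⁻¹) ^ (k + 1) * f (h * (k + 1)))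
    measurableSet_Ioc]
  · rw [setIntegral_const, measureReal_def, Real.volume_Ioc, ENNReal.toReal_ofReal (by nlinarith)]
    simp only [smul_eq_mul]
    ring
  · intro t ht
    simp only [laplaceStep, ceil_div_eq hh ht]
    push_cast
    rfl

lemma tendsto_mul_ceil {t : ℝ} (ht : 0 < t) :
    Tendsto (fun h : ℝ => h * ⌈t / h⌉₊) (𝓝[>] 0) (𝓝 t) := by
  have h1 : Tendsto (fun h : ℝ => t + h) (𝓝[>] 0) (𝓝 t) := by
    have : Tendsto (fun h : ℝ => t + h) (𝓝 0) (𝓝 (t + 0)) :=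
      (continuous_const.add continuous_id).tendsto 0
    simpa using this.mono_left nhdsWithin_le_nhds
  refine tendsto_of_tendsto_of_tendsto_of_le_of_le' tendsto_const_nhds h1 ?_ ?_
  · filter_upwards [self_mem_nhdsWithin] with h hh using le_mul_ceil hh t
  · filter_upwards [self_mem_nhdsWithin] with h hh
    have hh : 0 < h := hh
    have := (Nat.ceil_lt_add_one (a := t / h) (by positivity)).le
    calc h * (⌈t / h⌉₊ : ℝ) ≤ h * (t / h + 1) := by gcongr
      _ = t + h := by field_simp

lemma tendsto_laplaceStep {f : ℝ → ℝ} (hf : ContinuousOn f (Set.Ioi 0)) {p t : ℝ} (hp : 0 < p)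
    (ht : 0 < t) :
    Tendsto (fun h => laplaceStep p f h t) (𝓝[>] 0) (𝓝 (Real.exp (-p * t) * f t)) := by
  have hc := tendsto_mul_ceil ht
  refine Tendsto.mul ?_ ((hf.continuousAt (Ioi_mem_nhds ht)).tendsto.comp hc)
  have hlog : Tendsto (fun h : ℝ => h⁻¹ * Real.log (1 + p * h)) (𝓝[>] 0) (𝓝 p) := by
    have hd : HasDerivAt (fun h : ℝ => Real.log (1 + p * h)) p 0 := by
      have h1 : HasDerivAt (fun h : ℝ => 1 + p * h) p 0 := by
        simpa using ((hasDerivAt_id (0:ℝ)).const_mul p).const_add 1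
      simpa using h1.log (by simp)
    simpa using hd.tendsto_slope_zero_right
  have h2 : Tendsto (fun h : ℝ => Real.exp (-(h⁻¹ * Real.log (1 + p * h)) * (h * ⌈t / h⌉₊)))
      (𝓝[>] 0) (𝓝 (Real.exp (-p * t))) :=
    (Real.continuous_exp.tendsto _).comp (hlog.neg.mul hc)
  refine h2.congr' ?_
  filter_upwards [self_mem_nhdsWithin] with h hh
  have hh : 0 < h := hh
  have hpos : 0 < 1 + p * h := by positivity
  rw [← Real.exp_log (inv_pos.mpr hpos), ← Real.exp_nat_mul, Real.log_inv]
  congr 1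
  field_simp

lemma tendsto_integral_laplaceStep {f g : ℝ → ℝ} (hg : AntitoneOn g (Set.Ioi 0))
    (hfg : ∀ t ∈ Set.Ioi (0:ℝ), |f t| ≤ g t) (hgc : ContinuousOn g (Set.Ioi 0))
    (hgi : IntegrableOn g (Set.Ioc 0 1)) (hf : ContinuousOn f (Set.Ioi 0)) {p : ℝ} (hp : 0 < p) :
    Tendsto (fun h => ∫ t in Set.Ioi 0, laplaceStep p f h t) (𝓝[>] 0)
      (𝓝 (∫ t in Set.Ioi 0, Real.exp (-p * t) * f t)) := by
  refine tendsto_integral_filter_of_dominated_convergence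
    (fun t => Real.exp (-Real.log (1 + p) * t) * g t) ?_ ?_
    (integrableOn_exp_mul_of_antitoneOn hg (fun t ht => (abs_nonneg _).trans (hfg t ht)) hgc hgi
      (Real.log_pos (by linarith : 1 < 1 + p))) ?_
  · exact Eventually.of_forall fun h => (measurable_laplaceStep p f h).aestronglyMeasurable
  · filter_upwards [Ioc_mem_nhdsGT (zero_lt_one (α := ℝ))] with h hh
    filter_upwards [ae_restrict_mem measurableSet_Ioi] with t ht
    exact abs_laplaceStep_le hg hfg hp hh.1 hh.2 ht
  · filter_upwards [ae_restrict_mem measurableSet_Ioi] with t ht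
    exact tendsto_laplaceStep hf hp ht

lemma map_seqDiff_pow {E F : Type*} [AddCommGroup E] [Module ℝ E] [AddCommGroup F] [Module ℝ F]
    (T : E →ₗ[ℝ] F) (a : ℕ → E) (n k : ℕ) :
    T ((seqDiff E ^ n) a k) = (seqDiff F ^ n) (fun k => T (a k)) k := by
  induction n generalizing a with
  | zero => simp
  | succ n ih =>
    rw [pow_succ, pow_succ, Module.End.mul_apply, Module.End.mul_apply, ih]
    exact congrArg (fun b : ℕ → F => (seqDiff F ^ n) b k)
      (funext fun j => by simp [seqDiff_apply])

/-- The value of the quadratic form at `v`, as a linear map of the matrix. -/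
def quadFormAt {m : ℕ} (v : Fin m → ℝ) : Matrix (Fin m) (Fin m) ℝ →ₗ[ℝ] ℝ where
  toFun M := v ⬝ᵥ M *ᵥ v
  map_add' M N := by rw [add_mulVec, dotProduct_add]
  map_smul' c M := by rw [smul_mulVec, dotProduct_smul]; rfl

lemma MatCM.scalarCM {m : ℕ} {A : ℝ → Matrix (Fin m) (Fin m) ℝ} (hA : MatCM m A)
    (v : Fin m → ℝ) : ScalarCM (fun t => v ⬝ᵥ A t *ᵥ v) := by
  refine ⟨?_, hA.2 v⟩
  simp only [dotProduct_mulVec_eq_sum]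
  exact ContDiffOn.sum fun i _ => ContDiffOn.sum fun j _ => contDiffOn_const.mul (hA.1 i j)

lemma MatCM.seqDiff_pow_posSemidef {m : ℕ} {A : ℝ → Matrix (Fin m) (Fin m) ℝ} (hA : MatCM m A)
    (hpsd : ∀ t ∈ Set.Ioi (0:ℝ), (A t).PosSemidef) {h : ℝ} (hh : 0 < h) (n k : ℕ) :
    ((seqDiff _ ^ n) (fun k : ℕ => A (h * (k + 1))) k).PosSemidef := by
  refine posSemidef_iff_real.mpr ⟨fun i j => ?_, fun v => ?_⟩
  · have := map_seqDiff_pow (Matrix.entryLinearMap ℝ ℝ i j) (fun k : ℕ => A (h * (k + 1))) n k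
    have h2 := map_seqDiff_pow (Matrix.entryLinearMap ℝ ℝ j i) (fun k : ℕ => A (h * (k + 1))) n k
    simp only [Matrix.entryLinearMap_apply] at this h2
    rw [this, h2]
    exact congrArg (fun a : ℕ → ℝ => (seqDiff ℝ ^ n) a k) (funext fun k =>
      (posSemidef_iff_real.mp (hpsd (h * (k + 1)) (by simp only [Set.mem_Ioi]; positivity))).1 i j)
  · exact ((hA.scalarCM v).seqDiff_pow_nonneg hh n k).trans_eq
      (map_seqDiff_pow (quadFormAt v) (fun k : ℕ => A (h * (k + 1))) n k).symm

lemma MatCM.antitoneOn_trace {m : ℕ} {A : ℝ → Matrix (Fin m) (Fin m) ℝ} (hA : MatCM m A) :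
    AntitoneOn (fun t => (A t).trace) (Set.Ioi 0) := by
  intro s hs t ht hst
  refine Finset.sum_le_sum fun i _ => ?_
  simpa using (hA.scalarCM (Pi.single i 1)).antitoneOn hs ht hst

/-- The function `x ↦ 1 / (1 - x + p x)` on the unit interval; with `x = 1 / (1 + r)` this is
`(1 + r) / (p + r)`. -/
def kernelMap (p : ℝ) (hp : 0 < p) : C(unitInterval, ℝ) where
  toFun x := (1 - (x : ℝ) + p * x)⁻¹
  continuous_toFun := by
    refine Continuous.inv₀ (by fun_prop) fun x => ne_of_gt ?_
    rcases x.2.1.lt_or_eq with h | h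
    · have := x.2.2; nlinarith [mul_pos hp h]
    · rw [← h]; norm_num

/-- The change of variables `y ↦ h / (h + 1 - y)` of the unit interval. -/
def meshMap (h : ℝ) (hh : 0 < h) : C(unitInterval, unitInterval) where
  toFun y := ⟨h / (h + 1 - y), by
    have := y.2.2
    exact ⟨div_nonneg hh.le (by linarith), div_le_one_of_le₀ (by linarith) (by linarith)⟩⟩
  continuous_toFun := by
    refine Continuous.subtype_mk (Continuous.div (by fun_prop) (by fun_prop) fun y => ?_) _
    have := y.2.2
    linarith

/-- Transport of functions along `meshMap`, with weight. -/
def meshPullback (h : ℝ) (hh : 0 < h) : C(unitInterval, ℝ) →ₗ[ℝ] C(unitInterval, ℝ) where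
  toFun φ := (coordMap * φ).comp (meshMap h hh)
  map_add' φ ψ := by ext x; simp [mul_add]
  map_smul' c φ := by ext x; simp

lemma hasSum_meshPullback_kernelMap {h p : ℝ} (hh : 0 < h) (hp : 0 < p) :
    HasSum (fun k : ℕ => (h * ((1 + p * h)⁻¹) ^ (k + 1)) • coordMap ^ k)
      (meshPullback h hh (kernelMap p hp)) := by
  have hpos : 0 < 1 + p * h := by positivity
  set z : C(unitInterval, ℝ) := (1 + p * h)⁻¹ • coordMap with hz
  have hlt : (1 + p * h)⁻¹ < 1 := inv_lt_one_of_one_lt₀ (by linarith [mul_pos hp hh])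
  have hnorm : ‖z‖ < 1 := by
    refine lt_of_le_of_lt ((ContinuousMap.norm_le _ (inv_pos.mpr hpos).le).mpr fun x => ?_) hlt
    rw [hz, ContinuousMap.smul_apply, smul_eq_mul, norm_mul, Real.norm_of_nonneg
      (inv_pos.mpr hpos).le]
    refine mul_le_of_le_one_right (inv_pos.mpr hpos).le ?_
    exact (Real.norm_of_nonneg x.2.1).trans_le x.2.2
  have hs := (_root_.summable_geometric_of_norm_lt_one hnorm).hasSum
  have hmul := mul_neg_geom_series z hnorm
  have hs' := hs.const_smul (h * (1 + p * h)⁻¹)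
  have hterm : (fun k : ℕ => (h * ((1 + p * h)⁻¹) ^ (k + 1)) • coordMap ^ k)
      = fun k => (h * (1 + p * h)⁻¹) • z ^ k := by
    funext k
    rw [hz, smul_pow, smul_smul, pow_succ]
    congr 1
    ring
  have hsum : meshPullback h hh (kernelMap p hp)
      = (h * (1 + p * h)⁻¹) • ∑' k, z ^ k := by
    ext y
    have hy := congrArg (fun f : C(unitInterval, ℝ) => f y) hmul
    simp only [ContinuousMap.mul_apply, ContinuousMap.sub_apply, ContinuousMap.one_apply, hz,
      ContinuousMap.smul_apply, smul_eq_mul] at hy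
    have hy1 : (y : ℝ) ≤ 1 := y.2.2
    have hph := mul_pos hp hh
    have hd1 : 0 < h + 1 - (y : ℝ) := by linarith
    have hd2 : 0 < 1 + p * h - (y : ℝ) := by linarith
    have hcy : coordMap y = (y : ℝ) := rfl
    have hd3 : 1 - (1 + p * h)⁻¹ * (y : ℝ) = (1 + p * h - y) / (1 + p * h) := by field_simp
    rw [hcy, hd3] at hy
    have hval : (∑' i : ℕ, z ^ i) y = (1 + p * h) / (1 + p * h - y) := by
      rw [eq_div_iff hd2.ne']
      rw [div_mul_eq_mul_div, div_eq_iff hpos.ne'] at hy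
      linarith
    rw [ContinuousMap.smul_apply, hval, smul_eq_mul]
    change h / (h + 1 - (y : ℝ)) * (1 - h / (h + 1 - (y : ℝ)) + p * (h / (h + 1 - (y : ℝ))))⁻¹ = _
    have hd4 : 1 - h / (h + 1 - (y : ℝ)) + p * (h / (h + 1 - (y : ℝ)))
        = (1 + p * h - y) / (h + 1 - y) := by field_simp; ring
    rw [hd4]
    field_simp
  rw [hterm, hsum]
  exact hs'

lemma kernelMap_one : kernelMap 1 zero_lt_one = 1 := by
  ext x; simp [kernelMap]

/-- The Laplace transform of an LICM function is the image of the Stieltjes kernels under one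
positive functional on the compactified half-line. -/
lemma MatLICM.exists_posMap_laplace {m : ℕ} {A : ℝ → Matrix (Fin m) (Fin m) ℝ}
    (hA : MatLICM m A) (hpsd : ∀ t ∈ Set.Ioi (0:ℝ), (A t).PosSemidef) :
    ∃ Λ : C(unitInterval, ℝ) →ₗ[ℝ] Matrix (Fin m) (Fin m) ℝ, IsPosMap Λ ∧
      ∀ (p : ℝ) (hp : 0 < p), Λ (kernelMap p hp) = matLaplace m A p := by
  have hmom := fun (h : ℝ) (hh : 0 < h) =>
    exists_posMap_moments (hA.1.seqDiff_pow_posSemidef hpsd hh)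
  choose M hMpos hM using hmom
  have hg := hA.1.antitoneOn_trace
  have hAg : ∀ i j, ∀ t ∈ Set.Ioi (0:ℝ), |A t i j| ≤ (A t).trace := fun i j t ht =>
    PosSemidef.abs_apply_le_trace (hpsd t ht) i j
  have hgc : ContinuousOn (fun t => (A t).trace) (Set.Ioi 0) :=
    continuousOn_finsetSum _ fun i _ => (hA.1.1 i i).continuousOn
  have hgi : IntegrableOn (fun t => (A t).trace) (Set.Ioc 0 1) :=
    integrable_finsetSum _ fun i _ => hA.2 i i
  have hpos : ∀ n : ℕ, (0:ℝ) < 1 / (n + 1) := fun n => Nat.one_div_pos_of_nat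
  have hle : ∀ n : ℕ, (1:ℝ) / (n + 1) ≤ 1 := fun n => by
    rw [div_le_one (by positivity)]; linarith [(Nat.cast_nonneg n : (0:ℝ) ≤ n)]
  let L : ℕ → C(unitInterval, ℝ) →ₗ[ℝ] Matrix (Fin m) (Fin m) ℝ := fun n =>
    M (1 / (n + 1)) (hpos n) ∘ₗ meshPullback (1 / (n + 1)) (hpos n)
  have hL : ∀ n, IsPosMap (L n) := fun n φ hφ => hMpos _ (hpos n) _ fun x =>
    mul_nonneg (meshMap _ (hpos n) x).2.1 (hφ _)
  have hLk : ∀ n (p : ℝ) (hp : 0 < p) i j, L n (kernelMap p hp) i j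
      = ∫ t in Set.Ioi 0, laplaceStep p (fun t => A t i j) (1 / (n + 1)) t := by
    intro n p hp i j
    have h1 := ((hMpos _ (hpos n)).entryCLM i j).hasSum
      (hasSum_meshPullback_kernelMap (hpos n) hp)
    have h2 := hasSum_laplaceStep hg (hAg i j) hgc hgi hp (hpos n) (hle n)
    refine h1.unique (h2.congr_fun fun k => ?_)
    rw [map_smul, IsPosMap.entryCLM_apply, hM]
    rfl
  have hlim : ∀ (p : ℝ) (hp : 0 < p) i j,
      Tendsto (fun n => L n (kernelMap p hp) i j) atTop (𝓝 (matLaplace m A p i j)) := by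
    intro p hp i j
    simp only [hLk]
    have h0 : Tendsto (fun n : ℕ => (1:ℝ) / (n + 1)) atTop (𝓝[>] 0) :=
      tendsto_nhdsWithin_iff.mpr
        ⟨tendsto_one_div_add_atTop_nhds_zero_nat, Eventually.of_forall hpos⟩
    exact (tendsto_integral_laplaceStep hg (hAg i j) hgc hgi (hA.1.1 i j).continuousOn hp).comp h0
  have htr : Tendsto (fun n => (L n 1).trace) atTop (𝓝 (matLaplace m A 1).trace) := by
    rw [← kernelMap_one]
    exact tendsto_finsetSum _ fun i _ => hlim 1 zero_lt_one i i
  obtain ⟨C, hC⟩ := htr.bddAbove_range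
  obtain ⟨Λ, hΛ, hΛlim⟩ := exists_posMap_ultrafilter_limit (hyperfilter ℕ) L hL
    (fun n => hC ⟨n, rfl⟩)
  refine ⟨Λ, hΛ, fun p hp => ?_⟩
  ext i j
  exact tendsto_nhds_unique (hΛlim _ _ tendsto_const_nhds i j)
    ((hlim p hp i j).mono_left Nat.hyperfilter_le_atTop)

/-- Riesz representation on a compact space. -/
lemma exists_finiteMeasure_of_nonneg_functional {X : Type*} [TopologicalSpace X] [CompactSpace X]
    [T2Space X] [MeasurableSpace X] [BorelSpace X] (ℓ : C(X, ℝ) →ₗ[ℝ] ℝ)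
    (hℓ : ∀ φ : C(X, ℝ), (∀ x, 0 ≤ φ x) → 0 ≤ ℓ φ) :
    ∃ μ : Measure X, IsFiniteMeasure μ ∧ ∀ φ : C(X, ℝ), ∫ x, φ x ∂μ = ℓ φ := by
  let Λ : CompactlySupportedContinuousMap X ℝ →ₚ[ℝ] ℝ :=
    { toFun := fun g => ℓ g
      map_add' := fun f g => ℓ.map_add f g
      map_smul' := fun c g => ℓ.map_smul c g
      monotone' := fun f g hfg => by
        have h := hℓ ((g : C(X, ℝ)) - (f : C(X, ℝ))) fun x => sub_nonneg.mpr (hfg x)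
        rw [map_sub] at h
        exact sub_nonneg.mp h }
  exact ⟨RealRMK.rieszMeasure Λ, inferInstance, fun φ =>
    RealRMK.integral_rieszMeasure Λ (CompactlySupportedContinuousMap.continuousMapEquiv φ)⟩

/-- An integrable function with nonnegative integral against every nonnegative continuous function
is almost everywhere nonnegative. -/
lemma ae_nonneg_of_forall_integral_continuous_mul_nonneg {X : Type*} [TopologicalSpace X]
    [CompactSpace X] [T2Space X] [HasOuterApproxClosed X] [MeasurableSpace X] [BorelSpace X]
    {τ : Measure X} [IsFiniteMeasure τ] {g : X → ℝ} (hg : Integrable g τ)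
    (h : ∀ φ : C(X, ℝ), (∀ x, 0 ≤ φ x) → 0 ≤ ∫ x, φ x * g x ∂τ) : 0 ≤ᵐ[τ] g := by
  have hint : ∀ {u : X → ℝ}, Integrable u τ → ∀ φ : C(X, ℝ),
      Integrable (fun x => φ x * u x) τ := fun {u} hu φ => by
    refine hu.bdd_mul (c := ‖φ‖) φ.continuous.aestronglyMeasurable ?_
    exact Eventually.of_forall φ.norm_coe_le_norm
  obtain ⟨μ, hμfin, hμ⟩ := exists_finiteMeasure_of_nonneg_functional
    { toFun := fun φ : C(X, ℝ) => ∫ x, φ x * g x ∂τ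
      map_add' := fun φ ψ => by
        simp only [ContinuousMap.add_apply, add_mul]
        exact integral_add (hint hg φ) (hint hg ψ)
      map_smul' := fun c φ => by
        simp only [ContinuousMap.smul_apply, smul_eq_mul, mul_assoc, RingHom.id_apply]
        exact integral_const_mul c _ } h
  have hdens : ∀ {u : X → ℝ}, Integrable u τ → ∀ φ : C(X, ℝ),
      ∫ x, φ x ∂(τ.withDensity fun x => ENNReal.ofReal (u x)) = ∫ x, φ x * max (u x) 0 ∂τ := by
    intro u hu φ
    rw [integral_withDensity_eq_integral_toReal_smul₀ hu.1.aemeasurable.ennreal_ofReal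
      (Eventually.of_forall fun _ => ENNReal.ofReal_lt_top)]
    simp only [ENNReal.toReal_ofReal', smul_eq_mul, mul_comm]
  have : IsFiniteMeasure (τ.withDensity fun x => ENNReal.ofReal (g x)) :=
    isFiniteMeasure_withDensity_ofReal hg.2
  have : IsFiniteMeasure (τ.withDensity fun x => ENNReal.ofReal (-g x)) :=
    isFiniteMeasure_withDensity_ofReal hg.neg.2
  have hfin : ∀ (η : Measure X) [IsFiniteMeasure η] (φ : C(X, ℝ)), Integrable φ η :=
    fun η _ φ => φ.continuous.integrable_of_hasCompactSupport (HasCompactSupport.of_compactSpace _)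
  have heq : μ + τ.withDensity (fun x => ENNReal.ofReal (-g x))
      = τ.withDensity fun x => ENNReal.ofReal (g x) := by
    refine ext_of_forall_integral_eq_of_IsFiniteMeasure fun f => ?_
    have h1 := hdens hg f.toContinuousMap
    have h2 := hdens hg.neg f.toContinuousMap
    have h3 := hμ f.toContinuousMap
    change ∫ x, f.toContinuousMap x ∂_ = ∫ x, f.toContinuousMap x ∂_
    rw [integral_add_measure (hfin _ _) (hfin _ _), h1, h3]
    simp only [Pi.neg_apply] at h2
    rw [h2]
    change ∫ x, f.toContinuousMap x * g x ∂τ + _ = _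
    have hneg : Integrable (fun x => max (-g x) 0) τ := hg.neg.pos_part
    rw [← integral_add (hint hg _) (hint hneg _)]
    refine integral_congr_ae (Eventually.of_forall fun x => ?_)
    simp only
    rw [← mul_add]
    congr 1
    rcases le_total 0 (g x) with hx | hx
    · rw [max_eq_left hx, max_eq_right (neg_nonpos.mpr hx), add_zero]
    · rw [max_eq_right hx, max_eq_left (neg_nonneg.mpr hx), add_neg_cancel]
  refine ae_nonneg_of_forall_setIntegral_nonneg hg fun s hs _ => ?_
  rw [integral_eq_lintegral_pos_part_sub_lintegral_neg_part hg.restrict, sub_nonneg]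
  refine ENNReal.toReal_mono ?_ ?_
  · rw [← withDensity_apply _ hs]; exact measure_ne_top _ _
  · rw [← withDensity_apply _ hs, ← withDensity_apply _ hs, ← heq]
    exact le_add_self

/-- Matrix-valued Riesz representation of a positive map. -/
lemma IsPosMap.exists_density {X : Type*} [TopologicalSpace X]
    [CompactSpace X] [T2Space X] [HasOuterApproxClosed X] [MeasurableSpace X] [BorelSpace X]
    {m : ℕ} {L : C(X, ℝ) →ₗ[ℝ] Matrix (Fin m) (Fin m) ℝ} (hL : IsPosMap L) :
    ∃ (τ : Measure X) (H : X → Matrix (Fin m) (Fin m) ℝ), IsFiniteMeasure τ ∧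
      (∀ i j, Measurable fun x => H x i j) ∧ (∀ x, (H x).PosSemidef) ∧
      (∀ x i j, |H x i j| ≤ 1) ∧
      ∀ (φ : C(X, ℝ)) i j, ∫ x, φ x * H x i j ∂τ = L φ i j := by
  have hμ : ∀ i j : Fin m, ∃ μ : Measure X, IsFiniteMeasure μ ∧
      ∀ φ : C(X, ℝ), ∫ x, φ x ∂μ = L φ i i + (L φ i j + L φ j i) + L φ j j := fun i j => by
    refine exists_finiteMeasure_of_nonneg_functional
      { toFun := fun φ => L φ i i + (L φ i j + L φ j i) + L φ j j
        map_add' := fun φ ψ => by simp only [map_add, Matrix.add_apply]; ring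
        map_smul' := fun c φ => by
          simp only [map_smul, Matrix.smul_apply, smul_eq_mul, RingHom.id_apply]; ring }
      fun φ hφ => ?_
    have := (posSemidef_iff_real.mp (hL φ hφ)).2 (Pi.single i 1 + (1 : ℝ) • Pi.single j 1)
    rw [pair_quadForm] at this
    simpa using this
  choose μ hμfin hμ using hμ
  set τ : Measure X := ∑ i, ∑ j, μ i j with hτ
  have hle : ∀ i j, μ i j ≤ τ := fun i j => by
    rw [hτ]
    exact (Finset.single_le_sum (f := fun j => μ i j) (fun _ _ => Measure.zero_le _)
      (Finset.mem_univ j)).trans (Finset.single_le_sum (f := fun i => ∑ j, μ i j)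
        (fun _ _ => Measure.zero_le _) (Finset.mem_univ i))
  have hτfin : IsFiniteMeasure τ := by
    rw [hτ]; infer_instance
  set D : Fin m → Fin m → X → ℝ := fun i j x => ((μ i j).rnDeriv τ x).toReal with hD
  have hDmeas : ∀ i j, Measurable (D i j) := fun i j =>
    (Measure.measurable_rnDeriv _ _).ennreal_toReal
  have hDnn : ∀ i j x, 0 ≤ D i j x := fun i j x => ENNReal.toReal_nonneg
  have hDle : ∀ᵐ x ∂τ, ∀ i j, D i j x ≤ 1 := by
    simp only [ae_all_iff]
    intro i j
    filter_upwards [Measure.rnDeriv_le_one_of_le (hle i j)] with x hx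
    exact ENNReal.toReal_mono ENNReal.one_ne_top hx
  have hDint : ∀ i j, Integrable (D i j) τ := fun i j => Measure.integrable_toReal_rnDeriv
  have hint : ∀ (φ : C(X, ℝ)) {u : X → ℝ}, Integrable u τ →
      Integrable (fun x => φ x * u x) τ := fun φ u hu => by
    refine hu.bdd_mul (c := ‖φ‖) φ.continuous.aestronglyMeasurable ?_
    exact Eventually.of_forall φ.norm_coe_le_norm
  have hDval : ∀ (φ : C(X, ℝ)) i j,
      ∫ x, φ x * D i j x ∂τ = L φ i i + (L φ i j + L φ j i) + L φ j j := fun φ i j => by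
    rw [← hμ i j φ, ← integral_rnDeriv_smul (hle i j).absolutelyContinuous]
    simp only [smul_eq_mul, mul_comm, hD]
  set H₀ : Fin m → Fin m → X → ℝ := fun i j x =>
    (D i j x + D j i x) / 4 - D i i x / 8 - D j j x / 8 with hH₀
  have hHint : ∀ i j, Integrable (H₀ i j) τ := fun i j =>
    ((((hDint i j).add (hDint j i)).div_const 4).sub ((hDint i i).div_const 8)).sub
      ((hDint j j).div_const 8)
  have hLsymm : ∀ (φ : C(X, ℝ)) i j, L φ i j = L φ j i := by
    intro φ i j
    have h1 : (L (‖φ‖ • (1 : C(X, ℝ)) + φ)).PosSemidef := hL _ fun x => by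
      have := neg_le_of_abs_le (φ.norm_coe_le_norm x)
      simp only [ContinuousMap.add_apply, ContinuousMap.smul_apply,
        ContinuousMap.one_apply, smul_eq_mul]
      linarith
    have h2 : (L (1 : C(X, ℝ))).PosSemidef := hL _ fun x => by simp
    have e1 := (posSemidef_iff_real.mp h1).1 i j
    have e2 := (posSemidef_iff_real.mp h2).1 i j
    simp only [map_add, map_smul, Matrix.add_apply, Matrix.smul_apply, e2] at e1
    exact add_left_cancel e1
  have hHval : ∀ (φ : C(X, ℝ)) i j, ∫ x, φ x * H₀ i j x ∂τ = L φ i j := by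
    intro φ i j
    have e : (fun x => φ x * H₀ i j x) = fun x =>
        ((1 / 4) * (φ x * D i j x) + (1 / 4) * (φ x * D j i x))
          - (1 / 8) * (φ x * D i i x) - (1 / 8) * (φ x * D j j x) := by
      funext x; simp only [hH₀]; ring
    have I := fun i j => hint φ (hDint i j)
    have I₁ : Integrable (fun x => (1 / 4) * (φ x * D i j x) + (1 / 4) * (φ x * D j i x)) τ :=
      ((I i j).const_mul _).add ((I j i).const_mul _)
    have I₂ : Integrable (fun x => (1 / 4) * (φ x * D i j x) + (1 / 4) * (φ x * D j i x)
        - (1 / 8) * (φ x * D i i x)) τ := I₁.sub ((I i i).const_mul _)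
    rw [e, integral_sub I₂ ((I j j).const_mul _), integral_sub I₁ ((I i i).const_mul _),
      integral_add ((I i j).const_mul _) ((I j i).const_mul _)]
    simp only [integral_const_mul, hDval]
    rw [hLsymm φ j i]
    ring
  have hHmeas : ∀ i j, Measurable (H₀ i j) := fun i j => by
    simp only [hH₀]
    fun_prop
  have hpsd : ∀ᵐ x ∂τ, (Matrix.of fun i j => H₀ i j x).PosSemidef := by
    have hq : ∀ v : Fin m → ℝ,
        ∀ᵐ x ∂τ, 0 ≤ v ⬝ᵥ (Matrix.of fun i j => H₀ i j x) *ᵥ v := fun v => by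
      simp only [dotProduct_mulVec_eq_sum, Matrix.of_apply]
      have hsum : Integrable (fun x => ∑ i, ∑ j, v i * v j * H₀ i j x) τ :=
        integrable_finsetSum _ fun i _ => integrable_finsetSum _ fun j _ =>
          (hHint i j).const_mul _
      refine ae_nonneg_of_forall_integral_continuous_mul_nonneg hsum fun φ hφ => ?_
      have := (posSemidef_iff_real.mp (hL φ hφ)).2 v
      rw [dotProduct_mulVec_eq_sum] at this
      simp only [Finset.mul_sum]
      rw [integral_finsetSum _ fun i _ => integrable_finsetSum _ fun j _ =>
        hint φ ((hHint i j).const_mul _)]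
      refine this.trans_eq (Finset.sum_congr rfl fun i _ => ?_)
      rw [integral_finsetSum _ fun j _ => hint φ ((hHint i j).const_mul _)]
      refine Finset.sum_congr rfl fun j _ => ?_
      rw [← hHval φ i j, ← integral_const_mul]
      exact integral_congr_ae (Eventually.of_forall fun x => by simp only; ring)
    have hall := ae_all_iff.mpr fun n : ℕ => hq (TopologicalSpace.denseSeq (Fin m → ℝ) n)
    filter_upwards [hall] with x hx
    refine posSemidef_iff_real.mpr ⟨fun i j => ?_, fun v => ?_⟩
    · simp only [Matrix.of_apply, hH₀]; ring
    · have hcl : IsClosed {v : Fin m → ℝ | 0 ≤ v ⬝ᵥ (Matrix.of fun i j => H₀ i j x) *ᵥ v} := by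
        simp only [dotProduct_mulVec_eq_sum]
        exact isClosed_le continuous_const (by fun_prop)
      exact (hcl.closure_subset_iff.mpr (range_subset_iff.mpr hx))
        (TopologicalSpace.denseRange_denseSeq (Fin m → ℝ) v)
  have hbd : ∀ᵐ x ∂τ, ∀ i j, |H₀ i j x| ≤ 1 := by
    filter_upwards [hDle] with x hx i j
    simp only [hH₀]
    rw [abs_le]
    constructor <;>
      linarith [hx i j, hx j i, hx i i, hx j j, hDnn i j x, hDnn j i x, hDnn i i x, hDnn j j x]
  obtain ⟨N, hN, hNmeas, hN0⟩ := exists_measurable_superset_of_null (ae_iff.mp (hpsd.and hbd))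
  have hgood : ∀ x ∉ N, (Matrix.of fun i j => H₀ i j x).PosSemidef ∧ ∀ i j, |H₀ i j x| ≤ 1 :=
    fun x hx => by_contra fun hc => hx (hN hc)
  refine ⟨τ, Nᶜ.indicator fun x => Matrix.of fun i j => H₀ i j x, hτfin, fun i j => ?_,
    fun x => ?_, fun x i j => ?_, fun φ i j => ?_⟩
  · have e : (fun x => Nᶜ.indicator (fun x => Matrix.of fun i j => H₀ i j x) x i j)
        = Nᶜ.indicator (H₀ i j) := by
      funext x
      by_cases hx : x ∈ N <;> simp [hx]
    rw [e]
    exact (hHmeas i j).indicator hNmeas.compl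
  · by_cases hx : x ∈ N
    · simp [hx, Matrix.PosSemidef.zero]
    · simpa [hx] using (hgood x hx).1
  · by_cases hx : x ∈ N
    · simp [hx]
    · simpa [hx] using (hgood x hx).2 i j
  · rw [← hHval φ i j]
    refine integral_congr_ae ?_
    have hN' : ∀ᵐ x ∂τ, x ∉ N := measure_eq_zero_iff_ae_notMem.mp hN0
    filter_upwards [hN'] with x hx
    simp [hx]

/-- A positive map on `C([0, 1])` evaluated at the kernels `kernelMap p` gives a complete Bernstein
function after multiplication by `p`. -/
lemma isCBFM_of_posMap {m : ℕ} {L : C(unitInterval, ℝ) →ₗ[ℝ] Matrix (Fin m) (Fin m) ℝ}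
    (hL : IsPosMap L) {Y : ℝ → Matrix (Fin m) (Fin m) ℝ}
    (hY : ∀ (p : ℝ) (hp : 0 < p), L (kernelMap p hp) = Y p) :
    IsCBFM m fun p => p • Y p := by
  obtain ⟨τ, H, hτ, hHmeas, hHpsd, hHbd, hHL⟩ := hL.exists_density
  set S : Set unitInterval := {0}ᶜ with hS
  have hSmeas : MeasurableSet S := (measurableSet_singleton _).compl
  have hSpos : ∀ x ∈ S, 0 < (x : ℝ) := fun x hx => unitInterval.pos_iff_ne_zero.mpr hx
  set w : unitInterval → ENNReal := fun x => ENNReal.ofReal ((x : ℝ)⁻¹) with hw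
  have hwmeas : Measurable w := by simp only [hw]; fun_prop
  set ρ : unitInterval → ℝ := fun x => (x : ℝ)⁻¹ - 1 with hρ
  have hρmeas : Measurable ρ := by simp only [hρ]; fun_prop
  have hρnn : ∀ x ∈ S, 0 ≤ ρ x := fun x hx =>
    sub_nonneg.mpr ((one_le_inv₀ (hSpos x hx)).mpr x.2.2)
  set ν : Measure ℝ := ((τ.restrict S).withDensity w).map ρ with hν
  set G : ℝ → Matrix (Fin m) (Fin m) ℝ := fun r => H (projIcc 0 1 zero_le_one (1 + r)⁻¹) with hG
  have hGρ : ∀ x, G (ρ x) = H x := fun x => by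
    simp only [hG, hρ, add_sub_cancel, inv_inv, projIcc_val]
  have hGmeas : ∀ i j, Measurable fun r => G r i j := fun i j => by
    have : Measurable fun r : ℝ => projIcc (0 : ℝ) 1 zero_le_one (1 + r)⁻¹ :=
      continuous_projIcc.measurable.comp (by fun_prop)
    exact (hHmeas i j).comp this
  have hneg : ν (Set.Iio 0) = 0 := by
    rw [hν, Measure.map_apply hρmeas measurableSet_Iio,
      withDensity_apply _ (hρmeas measurableSet_Iio), Measure.restrict_restrict
        (hρmeas measurableSet_Iio)]
    have : ρ ⁻¹' Set.Iio 0 ∩ S = ∅ := by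
      ext x
      simp only [mem_inter_iff, mem_preimage, mem_Iio, mem_empty_iff_false, iff_false, not_and]
      exact fun hx hxS => (hρnn x hxS).not_gt hx
    rw [this]
    simp
  have hrestrict : ν.restrict (Set.Ici 0) = ν := by
    refine Measure.restrict_eq_self_of_ae_mem ?_
    rw [ae_iff]
    simpa [Set.Iio] using hneg
  refine ⟨(τ {0}).toReal • H 0, ν, G, (hHpsd 0).smul ENNReal.toReal_nonneg, hneg, ?_, hGmeas,
    Eventually.of_forall fun r => hHpsd _, ⟨1, Eventually.of_forall fun r => hHbd _⟩, ?_⟩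
  · rw [hrestrict, hν, lintegral_map (by fun_prop) hρmeas,
      lintegral_withDensity_eq_lintegral_mul _ hwmeas (by fun_prop)]
    calc ∫⁻ x in S, (w * fun x => ENNReal.ofReal ((1 + ρ x)⁻¹)) x ∂τ
        ≤ ∫⁻ x in S, 1 ∂τ := by
          refine setLIntegral_mono measurable_const fun x hx => ?_
          simp only [Pi.mul_apply, hw, hρ, add_sub_cancel, inv_inv]
          rw [← ENNReal.ofReal_mul (inv_nonneg.mpr x.2.1), inv_mul_cancel₀ (hSpos x hx).ne',
            ENNReal.ofReal_one]
      _ < ⊤ := by simp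
  · intro p hp
    have hp : 0 < p := hp
    ext i j
    simp only [Matrix.smul_apply, Matrix.add_apply, Matrix.of_apply, smul_eq_mul]
    have hmeas : Measurable fun r => p * (p + r)⁻¹ * G r i j :=
      (by fun_prop : Measurable fun r : ℝ => p * (p + r)⁻¹).mul (hGmeas i j)
    rw [← hY p hp, ← hHL, hrestrict, hν,
      integral_map hρmeas.aemeasurable hmeas.aestronglyMeasurable,
      integral_withDensity_eq_integral_toReal_smul hwmeas
        (Eventually.of_forall fun _ => ENNReal.ofReal_lt_top)]
    have hint : Integrable (fun x => kernelMap p hp x * H x i j) τ := by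
      refine Integrable.bdd_mul (c := ‖kernelMap p hp‖) ?_
        (kernelMap p hp).continuous.aestronglyMeasurable
        (Eventually.of_forall (kernelMap p hp).norm_coe_le_norm)
      refine Integrable.of_bound (C := 1) (hHmeas i j).aestronglyMeasurable ?_
      exact Eventually.of_forall fun x => hHbd x i j
    rw [← integral_add_compl (measurableSet_singleton (0 : unitInterval)) hint, mul_add]
    congr 1
    · rw [Measure.restrict_singleton, integral_smul_measure, integral_dirac]
      simp [kernelMap]
    · rw [← integral_const_mul]
      refine setIntegral_congr_fun hSmeas fun x hx => ?_
      have hx0 := hSpos x hx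
      simp only [hGρ, hw, ENNReal.toReal_ofReal (inv_nonneg.mpr x.2.1), smul_eq_mul]
      have hd : 0 < 1 - (x : ℝ) + p * x := by nlinarith [x.2.2, mul_pos hp hx0]
      change p * ((1 - (x : ℝ) + p * x)⁻¹ * _) = _
      have : p + ρ x = (1 - (x : ℝ) + p * x) / x := by
        simp only [hρ]; field_simp; ring
      rw [this, inv_div]
      field_simp

/-- If `A : (0,∞) → S₊` is an `S₊`-valued LICM function, then
`p ↦ p·Ã(p)`, where `Ã` is the Laplace transform of `A`, is an `S₊`-valued complete
Bernstein function on `(0,∞)`. -/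
theorem p_laplace_isCBF_of_LICM (m : ℕ) (A : ℝ → Matrix (Fin m) (Fin m) ℝ)
    (hA : MatLICM m A) (hpsd : ∀ t ∈ Set.Ioi (0:ℝ), (A t).PosSemidef) :
    IsCBFM m (fun p => p • matLaplace m A p) := by
  obtain ⟨Λ, hΛ, hlap⟩ := hA.exists_posMap_laplace hpsd
  exact isCBFM_of_posMap hΛ hlap
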